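/- For every α ∈ (0,1), the integral ∫_0^∞ (1 − J₀(s)) s^{−2−α} ds converges absolutely and equals 2^{−α−1} Γ(1/2 − α/2) / ( (α+1) Γ(3/2 + α/2) ). -/

import Mathlib

open MeasureTheory Real

/-- The Bessel function of the first kind of order 0:
`J₀(s) = (1/π) ∫_0^π cos(s sin θ) dθ`. -/
noncomputable def J0 (s : ℝ) : ℝ := (1 / π) * ∫ θ in (0:ℝ)..π, Real.cos (s * Real.sin θ)

/-- Tonelli's theorem for nonnegative kernels whose partial integrals are known. -/
theorem integrableOn_and_integral_eq_of_swap {s t : Set ℝ} {f : ℝ → ℝ → ℝ} {g h : ℝ → ℝ}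
    (hs : MeasurableSet s) (ht : MeasurableSet t) (hf : Measurable (Function.uncurry f))
    (hnn : ∀ x ∈ s, ∀ y ∈ t, 0 ≤ f x y)
    (hg : ∀ x ∈ s, ∫ y in t, f x y = g x)
    (hfi : ∀ y ∈ t, IntegrableOn (fun x => f x y) s)
    (hh : ∀ y ∈ t, ∫ x in s, f x y = h y)
    (hi : IntegrableOn h t) :
    IntegrableOn g s ∧ ∫ x in s, g x = ∫ y in t, h y := by
  have hprod : Integrable (Function.uncurry f)
      ((volume.restrict s).prod (volume.restrict t)) := by
    refine (integrable_prod_iff' hf.aestronglyMeasurable).2 ⟨?_, ?_⟩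
    · filter_upwards [ae_restrict_mem ht] with y hy using hfi y hy
    · refine Integrable.congr hi ?_
      filter_upwards [ae_restrict_mem ht] with y hy
      rw [← hh y hy]
      refine setIntegral_congr_fun hs fun x hx => ?_
      simp [abs_of_nonneg (hnn x hx y hy)]
  constructor
  · refine Integrable.congr hprod.integral_prod_left ?_
    filter_upwards [ae_restrict_mem hs] with x hx using hg x hx
  · rw [← setIntegral_congr_fun hs hg, ← setIntegral_congr_fun ht hh]
    exact integral_integral_swap hprod

theorem integrableOn_rpow_mul_exp_neg_mul {p b : ℝ} (hp : -1 < p) (hb : 0 < b) :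
    IntegrableOn (fun x : ℝ => x ^ p * rexp (-(b * x))) (Set.Ioi 0) := by
  simpa using integrableOn_rpow_mul_exp_neg_mul_rpow hp one_pos hb

theorem hasDerivAt_laplace_one_sub_cos {c t : ℝ} (ht : 0 < t) (u : ℝ) :
    HasDerivAt (fun u => rexp (-(t * u)) *
        ((t * Real.cos (c * u) - c * Real.sin (c * u)) / (c ^ 2 + t ^ 2) - 1 / t))
      ((1 - Real.cos (c * u)) * rexp (-(t * u))) u := by
  have h1 : HasDerivAt (fun u : ℝ => c * u) c u := by simpa using (hasDerivAt_id u).const_mul c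
  have h2 : HasDerivAt (fun u : ℝ => -(t * u)) (-t) u := by
    simp only [← neg_mul]
    simpa using (hasDerivAt_id u).const_mul (-t)
  refine (h2.exp.mul ((((h1.cos.const_mul t).sub (h1.sin.const_mul c)).div_const _).sub_const
    _)).congr_deriv ?_
  have : c ^ 2 + t ^ 2 ≠ 0 := by positivity
  simp only [Pi.sub_apply]
  field_simp
  ring

theorem tendsto_laplace_one_sub_cos {c t : ℝ} (ht : 0 < t) :
    Filter.Tendsto (fun u => rexp (-(t * u)) *
        ((t * Real.cos (c * u) - c * Real.sin (c * u)) / (c ^ 2 + t ^ 2) - 1 / t))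
      Filter.atTop (nhds 0) := by
  have hE : Filter.Tendsto (fun u => rexp (-(t * u))) Filter.atTop (nhds 0) :=
    Real.tendsto_exp_neg_atTop_nhds_zero.comp (Filter.tendsto_id.const_mul_atTop ht)
  refine hE.zero_mul_isBoundedUnder_le (Filter.isBoundedUnder_of
    ⟨(t + |c|) / (c ^ 2 + t ^ 2) + 1 / t, fun u => ?_⟩)
  have hd : 0 < c ^ 2 + t ^ 2 := by positivity
  refine (abs_sub _ _).trans (add_le_add ?_ (abs_of_pos (by positivity)).le)
  rw [abs_div, abs_of_pos hd]
  gcongr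
  refine (abs_sub _ _).trans ?_
  rw [abs_mul, abs_mul, abs_of_pos ht]
  exact add_le_add (mul_le_of_le_one_right ht.le (Real.abs_cos_le_one _))
    (mul_le_of_le_one_right (abs_nonneg c) (Real.abs_sin_le_one _))

theorem one_sub_cos_mul_exp_nonneg (c t u : ℝ) :
    0 ≤ (1 - Real.cos (c * u)) * rexp (-(t * u)) :=
  mul_nonneg (sub_nonneg.2 (Real.cos_le_one _)) (Real.exp_pos _).le

theorem integrableOn_one_sub_cos_mul_exp {c t : ℝ} (ht : 0 < t) :
    IntegrableOn (fun u => (1 - Real.cos (c * u)) * rexp (-(t * u))) (Set.Ioi 0) :=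
  integrableOn_Ioi_deriv_of_nonneg' (fun u _ => hasDerivAt_laplace_one_sub_cos ht u)
    (fun u _ => one_sub_cos_mul_exp_nonneg c t u) (tendsto_laplace_one_sub_cos ht)

theorem integral_one_sub_cos_mul_exp {c t : ℝ} (ht : 0 < t) :
    ∫ u in Set.Ioi 0, (1 - Real.cos (c * u)) * rexp (-(t * u)) =
      c ^ 2 / (t * (c ^ 2 + t ^ 2)) := by
  rw [integral_Ioi_of_hasDerivAt_of_nonneg' (fun u _ => hasDerivAt_laplace_one_sub_cos ht u)
    (fun u _ => one_sub_cos_mul_exp_nonneg c t u) (tendsto_laplace_one_sub_cos ht)]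
  have : c ^ 2 + t ^ 2 ≠ 0 := by positivity
  simp
  field_simp
  ring

theorem rpow_div_sq_add_sq_integral {α c : ℝ} (h0 : 0 < α) (h1 : α < 1) (hc : 0 < c) :
    IntegrableOn (fun t : ℝ => t ^ α / (c ^ 2 + t ^ 2)) (Set.Ioi 0) ∧
    ∫ t in Set.Ioi (0 : ℝ), t ^ α / (c ^ 2 + t ^ 2) =
      c ^ (α - 1) * (Real.Gamma (1 / 2 + α / 2) * Real.Gamma (1 / 2 - α / 2) / 2) := by
  have key := integrableOn_and_integral_eq_of_swap
    (s := Set.Ioi 0) (t := Set.Ioi 0)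
    (f := fun t x => t ^ α * rexp (-((c ^ 2 + t ^ 2) * x)))
    (g := fun t => t ^ α / (c ^ 2 + t ^ 2))
    (h := fun x => (x ^ (1 / 2 - α / 2 - 1) * rexp (-(c ^ 2 * x))) *
      (Real.Gamma (1 / 2 + α / 2) / 2))
    measurableSet_Ioi measurableSet_Ioi
    (by unfold Function.uncurry; fun_prop)
    (fun t ht x _ => mul_nonneg (Real.rpow_nonneg (le_of_lt ht) _) (Real.exp_pos _).le)
    ?_ ?_ ?_ ?_
  · refine ⟨key.1, key.2.trans ?_⟩
    rw [integral_mul_const, Real.integral_rpow_mul_exp_neg_mul_Ioi (by linarith) (by positivity)]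
    have : (1 / c ^ 2) ^ (1 / 2 - α / 2) = c ^ (α - 1) := by
      rw [one_div, ← Real.rpow_natCast, ← Real.rpow_neg hc.le, ← Real.rpow_mul hc.le]
      congr 1
      push_cast
      ring
    rw [this]
    ring
  · intro t _
    have hr : 0 < c ^ 2 + t ^ 2 := by positivity
    have := Real.integral_rpow_mul_exp_neg_mul_Ioi one_pos hr
    simp only [sub_self, Real.rpow_zero, one_mul, Real.rpow_one, Real.Gamma_one, mul_one] at this
    rw [integral_const_mul, this]
    ring
  · intro x hx
    have := (integrableOn_rpow_mul_exp_neg_mul_rpow (s := α) (by linarith) two_pos hx).mul_const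
      (rexp (-(c ^ 2 * x)))
    refine this.congr (Filter.Eventually.of_forall fun t => ?_)
    simp only [Real.rpow_two, mul_assoc, ← Real.exp_add]
    ring_nf
  · intro x hx
    have := integral_rpow_mul_exp_neg_mul_rpow (q := α) two_pos (by linarith) hx
    simp only [Real.rpow_two] at this
    have e : ∀ t : ℝ, t ^ α * rexp (-((c ^ 2 + t ^ 2) * x)) =
        (t ^ α * rexp (-x * t ^ 2)) * rexp (-(c ^ 2 * x)) := fun t => by
      rw [mul_assoc, ← Real.exp_add]
      ring_nf
    simp only [e]
    rw [integral_mul_const, this, show -(α + 1) / 2 = 1 / 2 - α / 2 - 1 by ring,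
      show (α + 1) / 2 = 1 / 2 + α / 2 by ring]
    ring
  · exact (integrableOn_rpow_mul_exp_neg_mul (by linarith) (by positivity)).mul_const _

theorem one_sub_cos_mul_rpow_integral {α c : ℝ} (h0 : 0 < α) (h1 : α < 1) (hc : 0 < c) :
    IntegrableOn (fun u : ℝ => (1 - Real.cos (c * u)) * u ^ (-2 - α)) (Set.Ioi 0) ∧
    ∫ u in Set.Ioi (0 : ℝ), (1 - Real.cos (c * u)) * u ^ (-2 - α) =
      c ^ (1 + α) * (Real.Gamma (1 / 2 + α / 2) * Real.Gamma (1 / 2 - α / 2) /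
        (2 * Real.Gamma (2 + α))) := by
  have hG : 0 < Real.Gamma (2 + α) := Real.Gamma_pos_of_pos (by linarith)
  have hB := rpow_div_sq_add_sq_integral h0 h1 hc
  have key := integrableOn_and_integral_eq_of_swap
    (s := Set.Ioi 0) (t := Set.Ioi 0)
    (f := fun u t => (1 - Real.cos (c * u)) * rexp (-(t * u)) * t ^ (2 + α - 1))
    (g := fun u => (1 - Real.cos (c * u)) * u ^ (-2 - α) * Real.Gamma (2 + α))
    (h := fun t => t ^ α / (c ^ 2 + t ^ 2) * c ^ 2)
    measurableSet_Ioi measurableSet_Ioi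
    (by unfold Function.uncurry; fun_prop)
    (fun u _ t ht => mul_nonneg (one_sub_cos_mul_exp_nonneg c t u)
      (Real.rpow_nonneg (le_of_lt ht) _))
    ?_ ?_ ?_ (hB.1.mul_const _)
  · constructor
    · refine (key.1.mul_const (Real.Gamma (2 + α))⁻¹).congr
        (Filter.Eventually.of_forall fun u => ?_)
      simp only [mul_assoc, mul_inv_cancel₀ hG.ne', mul_one]
    · have h2 := key.2
      rw [integral_mul_const, integral_mul_const, hB.2] at h2
      rw [eq_div_of_mul_eq hG.ne' h2, show 1 + α = (α - 1) + 2 by ring, Real.rpow_add hc,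
        Real.rpow_two]
      field_simp
  · intro u hu
    have := Real.integral_rpow_mul_exp_neg_mul_Ioi (a := 2 + α) (by linarith) hu
    have e : ∀ t : ℝ, (1 - Real.cos (c * u)) * rexp (-(t * u)) * t ^ (2 + α - 1) =
        (1 - Real.cos (c * u)) * (t ^ (2 + α - 1) * rexp (-(u * t))) := fun t => by
      rw [mul_comm t u]
      ring
    simp only [e]
    rw [integral_const_mul, this, one_div, Real.inv_rpow (le_of_lt hu),
      ← Real.rpow_neg (le_of_lt hu), neg_add']
    ring
  · intro t ht
    exact (integrableOn_one_sub_cos_mul_exp ht).mul_const _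
  · intro t ht
    have ht' : 0 < t := ht
    rw [integral_mul_const, integral_one_sub_cos_mul_exp ht',
      show 2 + α - 1 = α + 1 by ring, Real.rpow_add ht', Real.rpow_one]
    field_simp

theorem integral_sin_rpow {α : ℝ} (h0 : 0 < α) :
    ∫ θ in (0 : ℝ)..π, Real.sin θ ^ (1 + α) =
      2 ^ (1 + α) * (Real.Gamma (1 + α / 2) ^ 2 / Real.Gamma (2 + α)) := by
  have hsub := intervalIntegral.integral_comp_mul_deriv (a := 0) (b := π)
    (f := fun θ => (1 - Real.cos θ) / 2) (f' := fun θ => Real.sin θ / 2)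
    (g := fun y => y ^ (α / 2) * (1 - y) ^ (α / 2))
    (fun θ _ => (((Real.hasDerivAt_cos θ).const_sub 1).div_const 2).congr_deriv (by ring))
    (by fun_prop)
    ((continuous_id.rpow_const fun _ => Or.inr (by positivity)).mul
      ((continuous_const.sub continuous_id).rpow_const fun _ => Or.inr (by positivity)))
  have hbeta : ∫ y in (0 : ℝ)..1, y ^ (α / 2) * (1 - y) ^ (α / 2) =
      Real.Gamma (1 + α / 2) ^ 2 / Real.Gamma (2 + α) := by
    have h := ProbabilityTheory.beta_eq_betaIntegralReal (1 + α / 2) (1 + α / 2)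
      (by positivity) (by positivity)
    rw [ProbabilityTheory.beta, ← sq, show 1 + α / 2 + (1 + α / 2) = 2 + α by ring] at h
    rw [h, Complex.betaIntegral, ← Complex.ofReal_re (∫ y in (0 : ℝ)..1, _),
      ← intervalIntegral.integral_ofReal]
    congr 1
    refine intervalIntegral.integral_congr fun y hy => ?_
    rw [Set.uIcc_of_le zero_le_one] at hy
    simp only [Complex.ofReal_mul]
    rw [Complex.ofReal_cpow hy.1, Complex.ofReal_cpow (sub_nonneg.2 hy.2)]
    push_cast
    simp
  simp only [Real.cos_zero, sub_self, zero_div, Real.cos_pi, sub_neg_eq_add, one_add_one_eq_two,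
    div_self (two_ne_zero (α := ℝ)), hbeta] at hsub
  rw [← hsub, ← intervalIntegral.integral_const_mul]
  refine intervalIntegral.integral_congr fun θ hθ => ?_
  rw [Set.uIcc_of_le Real.pi_pos.le] at hθ
  have hs : 0 ≤ Real.sin θ := Real.sin_nonneg_of_mem_Icc hθ
  have e : (1 - Real.cos θ) / 2 * (1 - (1 - Real.cos θ) / 2) = (Real.sin θ / 2) ^ (2 : ℝ) := by
    rw [Real.rpow_two]
    linear_combination -(1 / 4 : ℝ) * Real.sin_sq_add_cos_sq θ
  simp only [Function.comp]
  rw [← Real.mul_rpow (by linarith [Real.cos_le_one θ]) (by linarith [Real.neg_one_le_cos θ]), e,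
    ← Real.rpow_mul (by positivity), mul_div_cancel₀ _ two_ne_zero, mul_comm (_ ^ α),
    ← Real.rpow_one_add' (by positivity) (by positivity), ← Real.mul_rpow two_pos.le (by positivity),
    mul_div_cancel₀ _ two_ne_zero]

theorem integral_one_sub_cos_mul_sin (s : ℝ) :
    ∫ θ in (0 : ℝ)..π, (1 - Real.cos (s * Real.sin θ)) = π * (1 - J0 s) := by
  rw [intervalIntegral.integral_sub (by simp)
    (Continuous.intervalIntegrable (by fun_prop) _ _), J0]
  simp
  field_simp

theorem gamma_duplication_quotient {α : ℝ} (h0 : 0 < α) :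
    (2 ^ (1 + α) * (Real.Gamma (1 + α / 2) ^ 2 / Real.Gamma (2 + α))) *
      (Real.Gamma (1 / 2 + α / 2) * Real.Gamma (1 / 2 - α / 2) / (2 * Real.Gamma (2 + α))) / π =
    2 ^ (-α - 1) * Real.Gamma (1 / 2 - α / 2) / ((α + 1) * Real.Gamma (3 / 2 + α / 2)) := by
  have hdup := Real.Gamma_mul_Gamma_add_half (1 + α / 2)
  have hrec := Real.Gamma_add_one (s := 1 / 2 + α / 2) (by positivity)
  rw [show 1 + α / 2 + 1 / 2 = 3 / 2 + α / 2 by ring, show 2 * (1 + α / 2) = 2 + α by ring,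
    show 1 - (2 + α) = -(1 + α) by ring, Real.rpow_neg two_pos.le] at hdup
  rw [show 1 / 2 + α / 2 + 1 = 3 / 2 + α / 2 by ring] at hrec
  rw [show -α - 1 = -(1 + α) by ring, Real.rpow_neg two_pos.le]
  have hP : (0 : ℝ) < 2 ^ (1 + α) := by positivity
  have hA : 0 < Real.Gamma (2 + α) := Real.Gamma_pos_of_pos (by positivity)
  have hC : 0 < Real.Gamma (3 / 2 + α / 2) := Real.Gamma_pos_of_pos (by positivity)
  have hpi : √π ^ 2 = π := Real.sq_sqrt Real.pi_pos.le
  have hb : Real.Gamma (1 / 2 + α / 2) = 2 * Real.Gamma (3 / 2 + α / 2) / (α + 1) := by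
    rw [hrec]
    field_simp
    ring
  have hg : Real.Gamma (1 + α / 2) =
      Real.Gamma (2 + α) * (2 ^ (1 + α))⁻¹ * √π / Real.Gamma (3 / 2 + α / 2) :=
    eq_div_of_mul_eq hC.ne' hdup
  have hpi0 := Real.pi_pos.ne'
  rw [hb, hg, div_pow, mul_pow, mul_pow, hpi]
  field_simp

/-- For every `α ∈ (0,1)`, the integral `∫_0^∞ (1 - J₀(s)) s^{-2-α} ds`
converges absolutely and equals `2^{-α-1} Γ(1/2-α/2)/((α+1) Γ(3/2+α/2))`. -/
theorem stmt7 (α : ℝ) (h0 : 0 < α) (h1 : α < 1) :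
    IntegrableOn (fun s : ℝ => (1 - J0 s) * s ^ (-2 - α)) (Set.Ioi 0) ∧
    ∫ s in Set.Ioi (0:ℝ), (1 - J0 s) * s ^ (-2 - α) =
      2 ^ (-α - 1) * Real.Gamma (1 / 2 - α / 2) / ((α + 1) * Real.Gamma (3 / 2 + α / 2)) := by
  set K := Real.Gamma (1 / 2 + α / 2) * Real.Gamma (1 / 2 - α / 2) / (2 * Real.Gamma (2 + α))
    with hK
  have hsin : ∀ θ ∈ Set.Ioo 0 π, 0 < Real.sin θ := fun θ hθ => Real.sin_pos_of_mem_Ioo hθ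
  have hsi : ContinuousOn (fun θ => Real.sin θ ^ (1 + α)) (Set.Icc 0 π) :=
    (Real.continuous_sin.rpow_const fun _ => Or.inr (by positivity)).continuousOn
  have key := integrableOn_and_integral_eq_of_swap
    (s := Set.Ioi 0) (t := Set.Ioo 0 π)
    (f := fun s θ => (1 - Real.cos (Real.sin θ * s)) * s ^ (-2 - α))
    (g := fun s => π * ((1 - J0 s) * s ^ (-2 - α)))
    (h := fun θ => Real.sin θ ^ (1 + α) * K)
    measurableSet_Ioi measurableSet_Ioo
    (by unfold Function.uncurry; fun_prop)
    (fun s hs θ _ => mul_nonneg (sub_nonneg.2 (Real.cos_le_one _))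
      (Real.rpow_nonneg (le_of_lt hs) _))
    (fun s _ => ?_)
    (fun θ hθ => (one_sub_cos_mul_rpow_integral h0 h1 (hsin θ hθ)).1)
    (fun θ hθ => (one_sub_cos_mul_rpow_integral h0 h1 (hsin θ hθ)).2)
    ((hsi.integrableOn_Icc.mono_set Set.Ioo_subset_Icc_self).mul_const _)
  · constructor
    · refine (key.1.const_mul π⁻¹).congr (Filter.Eventually.of_forall fun s => ?_)
      exact inv_mul_cancel_left₀ Real.pi_pos.ne' _
    · have h2 := key.2
      rw [integral_const_mul, integral_mul_const, ← integral_Ioc_eq_integral_Ioo,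
        ← intervalIntegral.integral_of_le Real.pi_pos.le, integral_sin_rpow h0] at h2
      rw [← gamma_duplication_quotient h0, ← hK, ← h2, mul_div_cancel_left₀ _ Real.pi_pos.ne']
  · rw [integral_mul_const, ← integral_Ioc_eq_integral_Ioo,
      ← intervalIntegral.integral_of_le Real.pi_pos.le]
    simp only [mul_comm (Real.sin _) s]
    rw [integral_one_sub_cos_mul_sin, mul_assoc]
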